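/- Let M be a von Neumann algebra acting on a separable Hilbert space and let f be a classically normal, singular pure state of M. Then there exists a projection p, minimal among the projections of the center of M, such that f(p) = 1, the corner pMp is a factor, and pMp is infinite-dimensional. -/

import Mathlib

open scoped ComplexOrder InnerProductSpace
open Filter Topology

noncomputable instance {H : Type*} [NormedAddCommGroup H] [InnerProductSpace ℂ H]
    [CompleteSpace H] : SMulMemClass (VonNeumannAlgebra H) ℂ (H →L[ℂ] H) :=
  ⟨fun {s} c {_} hx => s.toStarSubalgebra.smul_mem hx c⟩

/-- The σ-weak (ultraweak, weak*) topology on `B(H)`: the initial topology induced by the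
functionals `x ↦ ∑' n, ⟪ξ n, x (η n)⟫` over all pairs of square-summable sequences. -/
noncomputable def sigmaWeak (H : Type*) [NormedAddCommGroup H] [InnerProductSpace ℂ H]
    [CompleteSpace H] : TopologicalSpace (H →L[ℂ] H) :=
  ⨅ (ξ : ℕ → H) (η : ℕ → H) (_ : Summable fun n => ‖ξ n‖ ^ 2)
    (_ : Summable fun n => ‖η n‖ ^ 2),
    TopologicalSpace.induced (fun x : H →L[ℂ] H => ∑' n, ⟪ξ n, x (η n)⟫_ℂ) inferInstance

variable {H : Type*} [NormedAddCommGroup H] [InnerProductSpace ℂ H] [CompleteSpace H]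

/-- A positive linear functional on a von Neumann algebra. -/
def IsPosFunctional (M : VonNeumannAlgebra H) (f : ↥M →ₗ[ℂ] ℂ) : Prop :=
  ∀ a : ↥M, 0 ≤ f (star a * a)

/-- A state on a von Neumann algebra: a positive linear functional sending `1` to `1`. -/
def IsStateOn (M : VonNeumannAlgebra H) (f : ↥M →ₗ[ℂ] ℂ) : Prop :=
  IsPosFunctional M f ∧ f 1 = 1

/-- A pure state: a state such that every positive linear functional it dominates is a
nonnegative scalar multiple of it. -/
def IsPureStateOn (M : VonNeumannAlgebra H) (f : ↥M →ₗ[ℂ] ℂ) : Prop :=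
  IsStateOn M f ∧ ∀ g : ↥M →ₗ[ℂ] ℂ, IsPosFunctional M g → IsPosFunctional M (f - g) →
    ∃ t : ℝ, 0 ≤ t ∧ g = (t : ℂ) • f

/-- A functional on a von Neumann algebra is normal if it is continuous for the σ-weak
topology. -/
def IsNormalOn (M : VonNeumannAlgebra H) (f : ↥M →ₗ[ℂ] ℂ) : Prop :=
  @Continuous ↥M ℂ
    (TopologicalSpace.induced (fun x : ↥M => (x : H →L[ℂ] H)) (sigmaWeak H)) _ f

/-- A state on a von Neumann algebra is singular if the only normal positive linear
functional it dominates is `0`. -/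
def IsSingularOn (M : VonNeumannAlgebra H) (f : ↥M →ₗ[ℂ] ℂ) : Prop :=
  ∀ g : ↥M →ₗ[ℂ] ℂ, IsPosFunctional M g → IsPosFunctional M (f - g) → IsNormalOn M g → g = 0

/-- A projection: a self-adjoint idempotent. -/
def IsProjection (p : H →L[ℂ] H) : Prop := star p = p ∧ p * p = p

/-- `q` is a subprojection of `p` (i.e. `q ≤ p` for projections). -/
def ProjLE (q p : H →L[ℂ] H) : Prop := q * p = q ∧ p * q = q

/-- `p` is a minimal projection of the set `S`: a nonzero projection in `S` such that the
only projections of `S` below `p` are `0` and `p`. -/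
def IsMinimalProjectionIn (S : Set (H →L[ℂ] H)) (p : H →L[ℂ] H) : Prop :=
  p ∈ S ∧ IsProjection p ∧ p ≠ 0 ∧
    ∀ q ∈ S, IsProjection q → ProjLE q p → q = 0 ∨ q = p

/-- `f` is multiplicative on the subset `C` of `M`. -/
def IsMultiplicativeOn (M : VonNeumannAlgebra H) (f : ↥M →ₗ[ℂ] ℂ)
    (C : Set (H →L[ℂ] H)) : Prop :=
  ∀ a b : ↥M, (a : H →L[ℂ] H) ∈ C → (b : H →L[ℂ] H) ∈ C → f (a * b) = f a * f b

/-- `f` is normal on the von Neumann subalgebra `C` of `M` (where `C ⊆ M`): the restriction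
of `f` to `C` is σ-weakly continuous. -/
def IsNormalOnSub (M : VonNeumannAlgebra H) (f : ↥M →ₗ[ℂ] ℂ) (C : VonNeumannAlgebra H)
    (hC : (C : Set (H →L[ℂ] H)) ⊆ M) : Prop :=
  @Continuous ↥C ℂ
    (TopologicalSpace.induced (fun x : ↥C => (x : H →L[ℂ] H)) (sigmaWeak H)) _
    (fun x => f ⟨x, hC x.2⟩)

/-- A state on `M` is classically normal if it is normal on every von Neumann subalgebra
of `M` (with the same unit) on which it is multiplicative. -/
def IsClassicallyNormalOn (M : VonNeumannAlgebra H) (f : ↥M →ₗ[ℂ] ℂ) : Prop :=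
  ∀ (C : VonNeumannAlgebra H) (hC : (C : Set (H →L[ℂ] H)) ⊆ M),
    IsMultiplicativeOn M f (C : Set (H →L[ℂ] H)) → IsNormalOnSub M f C hC

/-- A von Neumann algebra is a factor if its center consists of the scalar multiples of
the identity. -/
def IsFactor (N : VonNeumannAlgebra H) : Prop :=
  ∀ x ∈ N, (∀ y ∈ N, x * y = y * x) → ∃ c : ℂ, x = c • (1 : H →L[ℂ] H)

/-- A positive operator on a Hilbert space. -/
def IsPositiveOp (a : H →L[ℂ] H) : Prop :=
  star a = a ∧ ∀ v : H, 0 ≤ ⟪v, a v⟫_ℂ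

/-- The corner `pMp` of a von Neumann algebra `M` by a projection `p`. -/
def corner (M : VonNeumannAlgebra H) (p : H →L[ℂ] H) : Set (H →L[ℂ] H) :=
  (fun x => p * x * p) '' (M : Set (H →L[ℂ] H))

/-- The corner `pMp` (with unit `p`) is a factor: its center consists of the scalar
multiples of its unit `p`. -/
def CornerIsFactor (M : VonNeumannAlgebra H) (p : H →L[ℂ] H) : Prop :=
  ∀ x ∈ corner M p, (∀ y ∈ corner M p, x * y = y * x) → ∃ c : ℂ, x = c • p

/-- The center of a von Neumann algebra `M`, as a subset of `B(H)`. -/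
def centerSet (M : VonNeumannAlgebra H) : Set (H →L[ℂ] H) :=
  {x | x ∈ M ∧ ∀ y ∈ M, x * y = y * x}

section Amplification

variable {E : Type*} [NormedAddCommGroup E] [InnerProductSpace ℂ E] [CompleteSpace E]

/-- The diagonal amplification of bounded operators on `E` to `ℓ²(ι, E)`. -/
noncomputable def lpAmplification (ι E : Type*) [NormedAddCommGroup E] [InnerProductSpace ℂ E]
    [CompleteSpace E] :
    (E →L[ℂ] E) →⋆ₐ[ℂ] (lp (fun _ : ι => E) 2 →L[ℂ] lp (fun _ : ι => E) 2) where
  toFun x := lp.mapCLM 2 (fun _ => x) (norm_nonneg x) (fun _ => le_rfl)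
  map_one' := by ext; simp
  map_mul' _ _ := by ext; simp
  map_zero' := by ext; simp
  map_add' _ _ := by ext; simp
  commutes' _ := by ext; simp [Algebra.algebraMap_eq_smul_one]
  map_star' x := by
    change _ = ContinuousLinearMap.adjoint _
    rw [
      ContinuousLinearMap.eq_adjoint_iff]
    intro a b
    simp [lp.inner_eq_tsum, ContinuousLinearMap.star_eq_adjoint,
      ContinuousLinearMap.adjoint_inner_left]

@[simp]
theorem lpAmplification_apply_apply {ι : Type*} (x : E →L[ℂ] E) (v : lp (fun _ : ι => E) 2)
    (i : ι) : lpAmplification ι E x v i = x (v i) := by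
  simp [lpAmplification]

/-- In a nondegenerate representation of a non-unital star algebra of operators, every vector is
a limit of its images. -/
theorem mem_closure_image_of_nondegenerate {K : Type*} [NormedAddCommGroup K]
    [InnerProductSpace ℂ K] [CompleteSpace K] (I : NonUnitalStarSubalgebra ℂ (E →L[ℂ] E))
    (π : (E →L[ℂ] E) →⋆ₐ[ℂ] (K →L[ℂ] K))
    (hπ : ∀ v, (∀ x ∈ I, π x v = 0) → v = 0) (v : K) :
    v ∈ closure ((fun x => π x v) '' (I : Set (E →L[ℂ] E))) := by
  let L : Submodule ℂ K :=
    { carrier := (fun x => π x v) '' (I : Set (E →L[ℂ] E))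
      add_mem' := by
        rintro _ _ ⟨x, hx, rfl⟩ ⟨y, hy, rfl⟩
        exact ⟨x + y, add_mem hx hy, by simp⟩
      zero_mem' := ⟨0, zero_mem I, by simp⟩
      smul_mem' := by
        rintro c _ ⟨x, hx, rfl⟩
        exact ⟨c • x, SMulMemClass.smul_mem c hx, by simp⟩ }
  have hL : ∀ x ∈ I, ∀ w ∈ L.topologicalClosure, π x w ∈ L.topologicalClosure := by
    intro x hx w hw
    refine map_mem_closure (π x).continuous hw ?_
    rintro _ ⟨y, hy, rfl⟩
    exact ⟨x * y, mul_mem hx hy, by simp⟩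
  have key : v - L.topologicalClosure.starProjection v = 0 := by
    refine hπ _ fun x hx => ?_
    have h1 : π x (v - L.topologicalClosure.starProjection v) ∈ L.topologicalClosure := by
      rw [map_sub]
      exact sub_mem (L.le_topologicalClosure ⟨x, hx, rfl⟩)
        (hL x hx _ (Submodule.starProjection_apply_mem _ _))
    have h2 : π x (v - L.topologicalClosure.starProjection v) ∈ L.topologicalClosureᗮ := by
      rw [Submodule.mem_orthogonal]
      intro w hw
      rw [← ContinuousLinearMap.adjoint_inner_left, ← ContinuousLinearMap.star_eq_adjoint,
        ← map_star]
      exact (Submodule.mem_orthogonal _ _).1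
        (Submodule.sub_starProjection_mem_orthogonal v) _ (hL _ (star_mem hx) w hw)
    exact inner_self_eq_zero.1 ((Submodule.mem_orthogonal _ _).1 h2 _ h1)
  have : v ∈ L.topologicalClosure := Submodule.starProjection_eq_self_iff.1 (sub_eq_zero.1 key).symm
  exact this

/-- The identity is a σ-weak limit of any nondegenerate star algebra of operators. -/
theorem one_mem_sigmaWeak_closure (I : NonUnitalStarSubalgebra ℂ (E →L[ℂ] E))
    (hI : ∀ v, (∀ x ∈ I, x v = 0) → v = 0) :
    (1 : E →L[ℂ] E) ∈ @closure _ (sigmaWeak E) (I : Set (E →L[ℂ] E)) := by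
  let Φ : (E →L[ℂ] E) → lp (fun _ : ℕ => E) 2 → lp (fun _ : ℕ => E) 2 :=
    fun x v => lpAmplification ℕ E x v
  have hle : TopologicalSpace.induced Φ inferInstance ≤ sigmaWeak E := by
    refine le_iInf fun ξ => le_iInf fun η => le_iInf fun hξ => le_iInf fun hη => ?_
    rw [← continuous_iff_le_induced]
    let ξ' : lp (fun _ : ℕ => E) 2 := ⟨ξ, memℓp_gen (by simpa using hξ)⟩
    let η' : lp (fun _ : ℕ => E) 2 := ⟨η, memℓp_gen (by simpa using hη)⟩
    have hfun : (fun x : E →L[ℂ] E => ∑' n, ⟪ξ n, x (η n)⟫_ℂ) =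
        (fun F : lp (fun _ : ℕ => E) 2 → lp (fun _ : ℕ => E) 2 => ⟪ξ', F η'⟫_ℂ) ∘ Φ := by
      ext x
      simp [Φ, lp.inner_eq_tsum, ξ', η']
    rw [hfun]
    have hc : Continuous fun F : lp (fun _ : ℕ => E) 2 → lp (fun _ : ℕ => E) 2 =>
        ⟪ξ', F η'⟫_ℂ := by fun_prop
    exact @Continuous.comp _ _ _ (TopologicalSpace.induced Φ inferInstance) _ _ _ _ hc
      continuous_induced_dom
  refine closure.mono hle ((closure_induced (f := Φ)).2 ?_)
  rw [mem_closure_iff]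
  intro o ho h1
  obtain ⟨S, u, hu, hSu⟩ := isOpen_pi_iff.1 ho _ h1
  let v : lp (fun _ : S => lp (fun _ : ℕ => E) 2) 2 :=
    ⟨fun s => s, memℓp_gen (summable_of_hasFiniteSupport (Set.toFinite _))⟩
  let π := (lpAmplification S (lp (fun _ : ℕ => E) 2)).comp (lpAmplification ℕ E)
  have hv : v ∈ closure ((fun x => π x v) '' (I : Set (E →L[ℂ] E))) := by
    refine mem_closure_image_of_nondegenerate I π (fun w hw => ?_) v
    ext s n
    refine hI _ fun x hx => ?_
    have := congrArg (fun w : lp (fun _ : S => lp (fun _ : ℕ => E) 2) 2 => w s n) (hw x hx)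
    simpa [π] using this
  have hopen : IsOpen (⋂ s : S, (lp.evalCLM ℂ (fun _ : S => lp (fun _ : ℕ => E) 2) 2 s) ⁻¹'
      (u s)) :=
    isOpen_iInter_of_finite fun s => (hu s s.2).1.preimage (ContinuousLinearMap.continuous _)
  obtain ⟨_, hw, x, hx, rfl⟩ := mem_closure_iff.1 hv _ hopen
    (Set.mem_iInter.2 fun s => by
      change v s ∈ u s
      simpa [Φ, v] using (hu s s.2).2)
  refine ⟨Φ x, hSu fun s hs => ?_, x, hx, rfl⟩
  have := Set.mem_iInter.1 hw ⟨s, hs⟩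
  change π x v ⟨s, hs⟩ ∈ u s at this
  simpa [π, Φ, v] using this

end Amplification

/-- The center of a von Neumann algebra, as a von Neumann algebra. -/
noncomputable def VonNeumannAlgebra.center (M : VonNeumannAlgebra H) : VonNeumannAlgebra H where
  toStarSubalgebra := M.toStarSubalgebra ⊓ M.commutant.toStarSubalgebra
  centralizer_centralizer' := by
    refine Set.Subset.antisymm (fun x hx => ⟨?_, ?_⟩) Set.subset_centralizer_centralizer
    · change x ∈ M.carrier
      rw [← M.centralizer_centralizer']
      exact Set.centralizer_subset (Set.centralizer_subset fun y hy => hy.1) hx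
    · change x ∈ M.commutant.carrier
      rw [← M.commutant.centralizer_centralizer']
      exact Set.centralizer_subset (Set.centralizer_subset fun y hy => hy.2) hx

theorem mem_center_iff {M : VonNeumannAlgebra H} {x : H →L[ℂ] H} :
    x ∈ M.center ↔ x ∈ centerSet M := by
  change x ∈ M ∧ x ∈ M.commutant ↔ _
  rw [VonNeumannAlgebra.mem_commutant_iff]
  exact and_congr_right fun _ => forall₂_congr fun _ _ => eq_comm

theorem VonNeumannAlgebra.sqrt_mem (M : VonNeumannAlgebra H) {a : H →L[ℂ] H} (ha : a ∈ M) :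
    CFC.sqrt a ∈ M := by
  rw [← M.commutant_commutant, VonNeumannAlgebra.mem_commutant_iff]
  intro y hy
  have hay : Commute a y := VonNeumannAlgebra.mem_commutant_iff.1 hy a ha
  exact (Commute.cfcₙ_nnreal hay NNReal.sqrt).symm

section PosFunctional

variable {M : VonNeumannAlgebra H} {f : ↥M →ₗ[ℂ] ℂ}

theorem IsPosFunctional.apply_star (hf : IsPosFunctional M f) (x : ↥M) :
    f (star x) = star (f x) := by
  have h0 := (Complex.nonneg_iff.1 (hf 1)).2
  have hx := (Complex.nonneg_iff.1 (hf x)).2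
  have h1 := (Complex.nonneg_iff.1 (hf (1 + x))).2
  have h2 := (Complex.nonneg_iff.1 (hf (1 + Complex.I • x))).2
  have e1 : star (1 + x) * (1 + x) = star (1 : ↥M) * 1 + x + star x + star x * x := by
    simp only [star_add, star_one]; noncomm_ring
  have e2 : star (1 + Complex.I • x) * (1 + Complex.I • x) =
      star (1 : ↥M) * 1 + Complex.I • x + (-Complex.I) • star x + star x * x := by
    apply Subtype.ext
    simp [mul_add, add_mul, smul_smul]
    abel
  rw [e1] at h1
  rw [e2] at h2
  simp at h0 hx h1 h2
  apply Complex.ext <;> simp <;> linarith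

/-- A positive functional, multiplied by a central positive element, stays positive. -/
theorem IsPosFunctional.nonneg_central_mul (hf : IsPosFunctional M f) {a : ↥M}
    (hac : (a : H →L[ℂ] H) ∈ centerSet M) (ha : 0 ≤ (a : H →L[ℂ] H)) (y : ↥M) :
    0 ≤ f (a * (star y * y)) := by
  have hs := mem_center_iff.1 (M.center.sqrt_mem (mem_center_iff.2 hac))
  let s : ↥M := ⟨CFC.sqrt (a : H →L[ℂ] H), hs.1⟩
  have hstar : star (CFC.sqrt (a : H →L[ℂ] H)) = CFC.sqrt (a : H →L[ℂ] H) :=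
    (IsSelfAdjoint.of_nonneg (CFC.sqrt_nonneg _)).star_eq
  have h : a * (star y * y) = star (s * y) * (s * y) := by
    apply Subtype.ext
    have hcomm := hs.2 _ (star_mem y.2)
    simp only [MulMemClass.coe_mul, StarMemClass.coe_star, star_mul, s, hstar]
    rw [← hcomm, mul_assoc, ← mul_assoc _ (CFC.sqrt (a : H →L[ℂ] H)), ← hcomm, mul_assoc,
      ← mul_assoc (CFC.sqrt _) (CFC.sqrt _), CFC.sqrt_mul_sqrt_self _ ha]
  rw [h]
  exact hf _

theorem IsPureStateOn.apply_selfAdjoint_central_mul (hf : IsPureStateOn M f) {a : ↥M}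
    (hac : (a : H →L[ℂ] H) ∈ centerSet M) (ha : IsSelfAdjoint (a : H →L[ℂ] H)) (x : ↥M) :
    f (a * x) = f a * f x := by
  let N : ℝ := ‖(a : H →L[ℂ] H)‖ + 1
  have hN : 0 < N := by positivity
  let l (b : ↥M) : ↥M →ₗ[ℂ] ℂ :=
    { toFun x := f (b * x)
      map_add' x y := by rw [mul_add, map_add]
      map_smul' c x := by
        rw [← map_smul f]
        exact congrArg f (Subtype.ext (by simp)) }
  have hN' : (N : ℂ) ≠ 0 := by exact_mod_cast hN.ne'
  have hl : ∀ b y : ↥M, f (((2 * N : ℂ)⁻¹ • ((N : ℂ) • 1 + b)) * y) =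
      (2 * N : ℂ)⁻¹ * (N * f y + f (b * y)) := by
    intro b y
    rw [← smul_eq_mul (N : ℂ), ← map_smul, ← map_add, ← smul_eq_mul (2 * N : ℂ)⁻¹, ← map_smul]
    exact congrArg f (Subtype.ext (by simp [add_mul]))
  have hone : ∀ c : ℂ, c • (1 : H →L[ℂ] H) ∈ M.center := fun c =>
    SMulMemClass.smul_mem c (one_mem _)
  have hpos : ∀ b : ↥M, (b : H →L[ℂ] H) ∈ centerSet M → IsSelfAdjoint (b : H →L[ℂ] H) →
      ‖(b : H →L[ℂ] H)‖ ≤ N → IsPosFunctional M (l ((2 * N : ℂ)⁻¹ • ((N : ℂ) • 1 + b))) := by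
    intro b hbc hb hbN y
    change 0 ≤ f (_ * (star y * y))
    refine hf.1.1.nonneg_central_mul ?_ ?_ y
    · rw [← mem_center_iff] at hbc ⊢
      exact SMulMemClass.smul_mem _ (add_mem (hone _) hbc)
    · have h1 : 0 ≤ algebraMap ℝ (H →L[ℂ] H) N + (b : H →L[ℂ] H) := by
        have := hb.neg_algebraMap_norm_le_self
        have h2 : algebraMap ℝ (H →L[ℂ] H) ‖(b : H →L[ℂ] H)‖ ≤ algebraMap ℝ _ N :=
          algebraMap_mono _ hbN
        exact neg_le_iff_add_nonneg'.1 ((neg_le_neg h2).trans this)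
      have h2 := smul_nonneg (inv_nonneg.2 (by positivity : 0 ≤ 2 * N)) h1
      convert h2 using 1
      ext v
      simp [Algebra.algebraMap_eq_smul_one, ← Complex.coe_smul]
  obtain ⟨t, -, ht⟩ := hf.2 _ (hpos a hac ha (by simp [N])) (by
    have := hpos (-a) (mem_center_iff.1 (neg_mem (mem_center_iff.2 hac))) ha.neg (by simp [N])
    convert this using 1
    ext y
    change f y - f (_ * y) = f (_ * y)
    rw [hl, hl, neg_mul, map_neg]
    field_simp
    ring)
  have hx := (hl a x).symm.trans (LinearMap.congr_fun ht x)
  have h1 := (hl a 1).symm.trans (LinearMap.congr_fun ht 1)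
  simp only [LinearMap.smul_apply, smul_eq_mul, mul_one, hf.1.2] at hx h1
  rw [← h1] at hx
  have := mul_left_cancel₀ (inv_ne_zero (mul_ne_zero two_ne_zero hN'))
    (hx.trans (mul_assoc _ _ _))
  linear_combination this

/-- A pure state is multiplicative with respect to central elements. -/
theorem IsPureStateOn.apply_central_mul (hf : IsPureStateOn M f) {z : ↥M}
    (hz : (z : H →L[ℂ] H) ∈ centerSet M) (x : ↥M) : f (z * x) = f z * f x := by
  have hmem : ∀ {w : H →L[ℂ] H}, w ∈ M.center → w ∈ M := fun h => (mem_center_iff.1 h).1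
  have hzc := mem_center_iff.2 hz
  have hre : (z + star z : H →L[ℂ] H) ∈ M.center := add_mem hzc (star_mem hzc)
  have him : (Complex.I • (z - star z) : H →L[ℂ] H) ∈ M.center :=
    SMulMemClass.smul_mem _ (sub_mem hzc (star_mem hzc))
  let a : ↥M := ⟨_, hmem hre⟩
  let b : ↥M := ⟨_, hmem him⟩
  have ha := hf.apply_selfAdjoint_central_mul (a := a) (mem_center_iff.1 hre)
    (IsSelfAdjoint.add_star_self _) x
  have hb := hf.apply_selfAdjoint_central_mul (a := b) (mem_center_iff.1 him)
    (by simp [b, IsSelfAdjoint, sub_eq_neg_add, add_comm]) x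
  have hdecomp : z = (2⁻¹ : ℂ) • a + (-(2⁻¹ * Complex.I) : ℂ) • b := by
    apply Subtype.ext
    simp only [AddMemClass.coe_add, SetLike.val_smul, a, b, smul_smul, neg_mul, mul_assoc,
      Complex.I_mul_I]
    module
  have hmul : z * x = (2⁻¹ : ℂ) • (a * x) + (-(2⁻¹ * Complex.I) : ℂ) • (b * x) := by
    conv_lhs => rw [hdecomp]
    exact Subtype.ext (by simp [add_mul])
  rw [hmul, hdecomp]
  simp only [map_add, map_smul, ha, hb, smul_eq_mul]
  ring

end PosFunctional

section CentralSupport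

variable {M : VonNeumannAlgebra H} {f : ↥M →ₗ[ℂ] ℂ}

/-- The joint eigenspace of the center of `M` for the eigenvalues prescribed by `f`. -/
def centralEigenspace (M : VonNeumannAlgebra H) (f : ↥M →ₗ[ℂ] ℂ) : Submodule ℂ H where
  carrier := {v | ∀ z : ↥M, (z : H →L[ℂ] H) ∈ centerSet M → (z : H →L[ℂ] H) v = f z • v}
  add_mem' hv hw z hz := by rw [map_add, hv z hz, hw z hz, smul_add]
  zero_mem' z _ := by simp
  smul_mem' c v hv z hz := by rw [map_smul, hv z hz, smul_comm]

theorem isClosed_centralEigenspace : IsClosed (centralEigenspace M f : Set H) := by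
  have : (centralEigenspace M f : Set H) = ⋂ (z : ↥M) (_ : (z : H →L[ℂ] H) ∈ centerSet M),
      {v | (z : H →L[ℂ] H) v = f z • v} := by
    ext v
    simp [centralEigenspace]
  rw [this]
  exact isClosed_iInter fun z => isClosed_iInter fun _ =>
    isClosed_eq (z : H →L[ℂ] H).continuous (continuous_const_smul _)

instance : CompleteSpace (centralEigenspace M f) :=
  isClosed_centralEigenspace.completeSpace_coe

theorem starProjection_centralEigenspace_mem :
    (centralEigenspace M f).starProjection ∈ M.center := by
  rw [VonNeumannAlgebra.IsStarProjection.mem_iff isStarProjection_starProjection]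
  intro y hy
  rw [Submodule.range_starProjection, Module.End.mem_invtSubmodule]
  intro v hv z hz
  have hzy := VonNeumannAlgebra.mem_commutant_iff.1 hy z (mem_center_iff.2 hz)
  have := congrArg (fun T : H →L[ℂ] H => T v) hzy
  simp only [mul_apply_eq_comp] at this
  change (z : H →L[ℂ] H) (y v) = f z • y v
  rw [this, hv z hz, map_smul]

theorem central_mul_starProjection_centralEigenspace {z : ↥M}
    (hz : (z : H →L[ℂ] H) ∈ centerSet M) :
    z * (centralEigenspace M f).starProjection =
      f z • (centralEigenspace M f).starProjection := by
  ext v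
  exact Submodule.starProjection_apply_mem (centralEigenspace M f) v z hz

/-- A pure state whose restriction to the center is normal has a nonzero central eigenspace. -/
theorem IsPureStateOn.starProjection_centralEigenspace_ne_zero (hf : IsPureStateOn M f)
    (hcn : IsClassicallyNormalOn M f) : (centralEigenspace M f).starProjection ≠ 0 := by
  intro hzero
  have hsub : (M.center : Set (H →L[ℂ] H)) ⊆ M := fun x hx => (mem_center_iff.1 hx).1
  have hcont := hcn M.center hsub fun a b ha _ => hf.apply_central_mul (mem_center_iff.1 ha) b
  let I : NonUnitalStarSubalgebra ℂ (H →L[ℂ] H) :=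
    { carrier := {x | ∃ h : x ∈ M.center, f ⟨x, hsub h⟩ = 0}
      add_mem' := by
        rintro x y ⟨hx, hx0⟩ ⟨hy, hy0⟩
        refine ⟨add_mem hx hy, ?_⟩
        have := map_add f ⟨x, hsub hx⟩ ⟨y, hsub hy⟩
        rwa [hx0, hy0, add_zero] at this
      zero_mem' := ⟨zero_mem _, map_zero f⟩
      mul_mem' := by
        rintro x y ⟨hx, hx0⟩ ⟨hy, hy0⟩
        refine ⟨mul_mem hx hy, ?_⟩
        have := hf.apply_central_mul (z := ⟨x, hsub hx⟩) (mem_center_iff.1 hx) ⟨y, hsub hy⟩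
        rwa [hx0, zero_mul] at this
      smul_mem' := by
        rintro c x ⟨hx, hx0⟩
        refine ⟨SMulMemClass.smul_mem c hx, ?_⟩
        have := map_smul f c ⟨x, hsub hx⟩
        rwa [hx0, smul_zero] at this
      star_mem' := by
        rintro x ⟨hx, hx0⟩
        refine ⟨star_mem hx, ?_⟩
        have := hf.1.1.apply_star ⟨x, hsub hx⟩
        rwa [hx0, star_zero] at this }
  have hI : ∀ v, (∀ x ∈ I, x v = 0) → v = 0 := by
    intro v hv
    have hvK : v ∈ centralEigenspace M f := by
      intro z hz
      have hmem : (z : H →L[ℂ] H) - f z • 1 ∈ M.center :=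
        sub_mem (mem_center_iff.2 hz) (SMulMemClass.smul_mem _ (one_mem _))
      have h0 : f (z - f z • 1) = 0 := by
        rw [map_sub, map_smul, hf.1.2, smul_eq_mul, mul_one, sub_self]
      have := hv _ ⟨hmem, h0⟩
      simpa [sub_eq_zero] using this
    rw [← Submodule.starProjection_eq_self_iff.2 hvK, hzero, zero_apply]
  let τ : TopologicalSpace ↥M.center :=
    TopologicalSpace.induced (fun x : ↥M.center => (x : H →L[ℂ] H)) (sigmaWeak H)
  have hone : (1 : ↥M.center) ∈ @closure _ τ {x | f ⟨x, hsub x.2⟩ = 0} := by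
    rw [@closure_induced _ _ (sigmaWeak H)]
    refine (@closure_mono _ (sigmaWeak H) _ _ ?_) (one_mem_sigmaWeak_closure I hI)
    rintro x ⟨hx, hx0⟩
    exact ⟨⟨x, hx⟩, hx0, rfl⟩
  have hclosed : @IsClosed _ τ {x : ↥M.center | f ⟨x, hsub x.2⟩ = 0} :=
    @IsClosed.preimage _ _ τ _ _ hcont {0} isClosed_singleton
  rw [@IsClosed.closure_eq _ τ _ hclosed] at hone
  exact one_ne_zero (hf.1.2.symm.trans hone)

end CentralSupport

/-- Matrix coefficients are σ-weakly continuous. -/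
theorem continuous_sigmaWeak_inner (ξ η : H) :
    @Continuous _ _ (sigmaWeak H) _ fun x : H →L[ℂ] H => ⟪ξ, x η⟫_ℂ := by
  have hs : ∀ v : H, Summable fun n => ‖(Pi.single 0 v : ℕ → H) n‖ ^ 2 := fun v =>
    summable_of_ne_finset_zero (s := {0}) fun n hn => by
      simp [Pi.single_eq_of_ne (Finset.notMem_singleton.1 hn)]
  rw [continuous_iff_le_induced]
  refine iInf_le_of_le (Pi.single 0 ξ) (iInf_le_of_le (Pi.single 0 η)
    (iInf_le_of_le (hs ξ) (iInf_le_of_le (hs η) (le_of_eq ?_))))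
  congr 1
  ext x
  rw [tsum_eq_single 0 fun n hn => by simp [Pi.single_eq_of_ne hn]]
  simp

/-- A functional factoring through a compression to a finite-dimensional corner is normal. -/
theorem isNormalOn_of_finiteDimensional_corner {M : VonNeumannAlgebra H} {f : ↥M →ₗ[ℂ] ℂ}
    (p : ↥M) (hp : ∀ x, f (p * x * p) = f x)
    (hfin : FiniteDimensional ℂ (Submodule.span ℂ (corner M (p : H →L[ℂ] H)))) :
    IsNormalOn M f := by
  let V := Submodule.span ℂ (corner M (p : H →L[ℂ] H))
  have hV : ∀ x ∈ V, x ∈ M := fun x hx => by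
    have hle : V ≤ M.toStarSubalgebra.toSubalgebra.toSubmodule := by
      refine Submodule.span_le.2 ?_
      rintro _ ⟨y, hy, rfl⟩
      exact (mul_mem (mul_mem p.2 hy) p.2 : _ ∈ M)
    exact hle hx
  let e := ContinuousLinearMapWOT.linearEquiv (σ := RingHom.id ℂ) (E := H) (F := H) ℂ
  let W : Submodule ℂ (H →WOT[ℂ] H) := V.comap e.toLinearMap
  have : FiniteDimensional ℂ W := by
    have he : W = V.map e.symm.toLinearMap := Submodule.comap_equiv_eq_map_symm e V
    rw [he]
    infer_instance
  let g : W →ₗ[ℂ] ℂ :=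
    { toFun w := f ⟨e w, hV _ w.2⟩
      map_add' v w := map_add f ⟨e v, hV _ v.2⟩ ⟨e w, hV _ w.2⟩
      map_smul' c w := map_smul f c ⟨e w, hV _ w.2⟩ }
  have hg : Continuous g := g.continuous_of_finiteDimensional
  let c : ↥M → W := fun x =>
    ⟨e.symm (p * x * p), Submodule.subset_span ⟨x, x.2, rfl⟩⟩
  have hfg : (f : ↥M → ℂ) = g ∘ c := by
    ext x
    exact (hp x).symm
  let τ : TopologicalSpace ↥M :=
    TopologicalSpace.induced (fun x : ↥M => (x : H →L[ℂ] H)) (sigmaWeak H)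
  have hc : Continuous c := by
    refine Continuous.subtype_mk (ContinuousLinearMapWOT.continuous_iff.2 fun ξ η => ?_) _
    have h := @Continuous.comp _ _ _ τ (sigmaWeak H) _ _ _
      (continuous_sigmaWeak_inner (star (p : H →L[ℂ] H) η) ((p : H →L[ℂ] H) ξ))
      continuous_induced_dom
    convert h using 2 with x
    simp only [Function.comp_apply, ContinuousLinearMap.star_eq_adjoint,
      ContinuousLinearMap.adjoint_inner_left]
    rfl
  change Continuous f
  rw [hfg]
  exact hg.comp hc


/-- If `f` is a classically normal, singular pure state on a von Neumann algebra `M` on a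
separable Hilbert space, then there is a projection `p`, minimal among projections of the
center of `M`, with `f p = 1` such that `pMp` is an infinite-dimensional factor. -/
theorem classically_normal_singular_pure_state_central_support
    [TopologicalSpace.SeparableSpace H]
    (M : VonNeumannAlgebra H) (f : ↥M →ₗ[ℂ] ℂ)
    (hf : IsPureStateOn M f) (hsing : IsSingularOn M f) (hcn : IsClassicallyNormalOn M f) :
    ∃ p : ↥M, IsMinimalProjectionIn (centerSet M) ((p : H →L[ℂ] H)) ∧ f p = 1 ∧
      CornerIsFactor M (p : H →L[ℂ] H) ∧
      ¬ FiniteDimensional ℂ ↥(Submodule.span ℂ (corner M (p : H →L[ℂ] H))) := by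
  have hpc := mem_center_iff.1 (starProjection_centralEigenspace_mem (M := M) (f := f))
  have hzp := fun z : ↥M => central_mul_starProjection_centralEigenspace (f := f) (z := z)
  have hp0 := hf.starProjection_centralEigenspace_ne_zero hcn
  have hproj : IsStarProjection (centralEigenspace M f).starProjection :=
    isStarProjection_starProjection
  generalize (centralEigenspace M f).starProjection = q at hpc hzp hp0 hproj
  have hqq : q * q = q := hproj.isIdempotentElem
  let p : ↥M := ⟨q, hpc.1⟩
  have hfp : f p = 1 := by
    have h := hzp p hpc
    change q * q = _ at h
    rw [hqq] at h
    by_contra hne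
    have h' : (1 - f p) • q = 0 := by rw [sub_smul, one_smul, ← h, sub_self]
    exact (smul_eq_zero.1 h').elim (fun h => hne (sub_eq_zero.1 h).symm) hp0
  refine ⟨p, ⟨hpc, ⟨hproj.isSelfAdjoint, hqq⟩, hp0, ?_⟩, hfp, ?_, ?_⟩
  · intro r hr hrp hle
    have h : r = f ⟨r, hr.1⟩ • q := hle.1.symm.trans (hzp ⟨r, hr.1⟩ hr)
    have hidem : f ⟨r, hr.1⟩ = f ⟨r, hr.1⟩ * f ⟨r, hr.1⟩ := by
      rw [← hf.apply_central_mul (z := ⟨r, hr.1⟩) hr]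
      exact congrArg f (Subtype.ext hrp.2.symm)
    rcases IsIdempotentElem.iff_eq_zero_or_one.1 hidem.symm with h0 | h1
    · left
      rw [h, h0, zero_smul]
    · right
      rw [h, h1, one_smul]
  · rintro _ ⟨y, hy, rfl⟩ hcomm
    have hxM : q * y * q ∈ M := mul_mem (mul_mem hpc.1 hy) hpc.1
    have hxc : q * y * q ∈ centerSet M := by
      refine ⟨hxM, fun m hm => ?_⟩
      have h := hcomm _ ⟨m, hm, rfl⟩
      change q * y * q * (q * m * q) = q * m * q * (q * y * q) at h
      have h1 : q * m * q = q * m := by rw [mul_assoc, ← hpc.2 m hm, ← mul_assoc, hqq]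
      have h2 : q * m = m * q := hpc.2 m hm
      calc q * y * q * m = q * y * q * (q * m * q) := by
            rw [h1, ← mul_assoc, mul_assoc _ q q, hqq]
        _ = q * m * q * (q * y * q) := h
        _ = m * (q * y * q) := by
            rw [h1, h2, mul_assoc, ← mul_assoc q, ← mul_assoc q, hqq]
    refine ⟨f ⟨_, hxM⟩, ?_⟩
    rw [← hzp ⟨_, hxM⟩ hxc]
    change q * y * q = q * y * q * q
    rw [mul_assoc _ q q, hqq]
  · intro hfin
    have hfpx : ∀ x, f (p * x * p) = f x := fun x => by
      have h : p * x * p = p * (p * x) := Subtype.ext (by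
        change q * x * q = q * (q * x)
        rw [mul_assoc, ← hpc.2 x x.2])
      rw [h, hf.apply_central_mul hpc, hf.apply_central_mul hpc, hfp, one_mul, one_mul]
    have hf0 := hsing f hf.1.1 (fun a => by simp)
      (isNormalOn_of_finiteDimensional_corner p hfpx hfin)
    have h1 := hf.1.2
    rw [hf0] at h1
    exact zero_ne_one h1
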